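/- For any prime p > 3 and integers 0 < r < m with gcd(m,p) = 1, setting x = r/m and a ≥ 1 an integer: (x)_{ap}(1-x)_{ap}/((1)_{ap})^2 ≡ ((x)_{(a-1)p}(1-x)_{(a-1)p}/((1)_{(a-1)p})^2) · ((x)_p(1-x)_p/((1)_p)^2) · (1/a^2) · (1 + a(a-1)·m^2/([r/p]_m · [-r/p]_m)) (mod p^3), as a congruence of p-adic numbers. -/

import Mathlib

def pcong (p k : ℕ) (a b : ℚ) : Prop := ∃ c : ℚ, ¬ p ∣ c.den ∧ a - b = (p : ℚ) ^ k * c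

open Finset in
theorem sum_range_inv_sq_eq_zero (p : ℕ) [Fact p.Prime] (hp3 : 3 < p) (r m : ZMod p)
    (hm : m ≠ 0) : ∑ j ∈ range p, ((r + j * m) ^ 2)⁻¹ = 0 := by
  have hrange : ∑ j ∈ range p, ((r + (j : ZMod p) * m) ^ 2)⁻¹ =
      ∑ x : ZMod p, ((r + x * m) ^ 2)⁻¹ := by
    refine sum_nbij (fun j => (j : ZMod p)) (fun _ _ => mem_univ _) ?_ ?_ (fun _ _ => rfl)
    · intro i hi j hj hij
      simp only [coe_range, Set.mem_Iio] at hi hj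
      have := (ZMod.natCast_eq_natCast_iff' i j p).1 hij
      rwa [Nat.mod_eq_of_lt hi, Nat.mod_eq_of_lt hj] at this
    · intro x _
      exact ⟨x.val, by simpa using ZMod.val_lt x, by simp⟩
  rw [hrange, ← FiniteField.sum_pow_lt_card_sub_one (K := ZMod p) 2
    (by rw [ZMod.card]; have := (Fact.out : p.Prime).eq_one_or_self_of_dvd 2; omega)]
  refine Fintype.sum_equiv
    (((Equiv.mulRight₀ m hm).trans (Equiv.addLeft r)).trans (Equiv.inv (ZMod p))) _ _ ?_
  intro x
  simp

open Finset in
theorem exists_prod_add_sq_mul (p : ℕ) [Fact p.Prime] (s : Finset ℕ) (c : ℕ → ℤ) (t : ℤ)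
    (hc : ∀ j ∈ s, ((c j : ℤ) : ZMod p) ≠ 0) :
    ∃ σ q : ℤ, ∏ j ∈ s, (c j + p ^ 2 * t) = ∏ j ∈ s, c j + p ^ 2 * t * σ + p ^ 3 * q ∧
      (σ : ZMod p) = (∏ j ∈ s, (c j : ZMod p)) * ∑ j ∈ s, (c j : ZMod p)⁻¹ := by
  induction s using Finset.induction_on with
  | empty => exact ⟨0, 0, by simp, by simp⟩
  | insert a s ha ih =>
    obtain ⟨σ, q, h1, h2⟩ := ih fun j hj => hc j (mem_insert_of_mem hj)
    have hca := hc a (mem_insert_self a s)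
    refine ⟨c a * σ + ∏ j ∈ s, c j, c a * q + p * t ^ 2 * σ + p ^ 2 * t * q, ?_, ?_⟩
    · rw [prod_insert ha, prod_insert ha, h1]
      ring
    · rw [prod_insert ha, sum_insert ha]
      push_cast
      rw [h2]
      field_simp
      ring

section Block

variable {p : ℕ} [Fact p.Prime] {r m : ℤ} {i₀ : ℕ}

theorem add_mul_ne_zero_of_mem_erase (hm : (m : ZMod p) ≠ 0) (hi : i₀ < p)
    (h0 : (r + i₀ * m : ZMod p) = 0) {j : ℕ} (hj : j ∈ (Finset.range p).erase i₀) :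
    (r + j * m : ZMod p) ≠ 0 := by
  intro h
  rw [Finset.mem_erase, Finset.mem_range] at hj
  have h1 : (j : ZMod p) = i₀ := mul_right_cancel₀ hm (by linear_combination h - h0)
  have := (ZMod.natCast_eq_natCast_iff' j i₀ p).1 h1
  rw [Nat.mod_eq_of_lt hi, Nat.mod_eq_of_lt hj.2] at this
  exact hj.1 this

open Finset in
theorem pow_three_dvd_prod_erase_sub (hp3 : 3 < p) (hm : (m : ZMod p) ≠ 0) (hi : i₀ < p)
    (h0 : (r + i₀ * m : ZMod p) = 0) (t : ℤ) :
    (p : ℤ) ^ 3 ∣ ∏ j ∈ (range p).erase i₀, ((r + j * m) * (p * m - r - j * m) + p ^ 2 * t) -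
      ∏ j ∈ (range p).erase i₀, ((r + j * m) * (p * m - r - j * m)) := by
  have hcast : ∀ j : ℕ, (((r + j * m) * (p * m - r - j * m) : ℤ) : ZMod p) =
      -(r + j * m : ZMod p) ^ 2 := by
    intro j
    push_cast
    rw [ZMod.natCast_self]
    ring
  obtain ⟨σ, q, h1, h2⟩ := exists_prod_add_sq_mul p ((range p).erase i₀)
    (fun j => (r + j * m) * (p * m - r - j * m)) t (by
      intro j hj
      rw [hcast]
      exact neg_ne_zero.2 (pow_ne_zero _ (add_mul_ne_zero_of_mem_erase hm hi h0 hj)))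
  have hσ : (σ : ZMod p) = 0 := by
    rw [h2]
    refine mul_eq_zero_of_right _ ?_
    simp only [hcast, inv_neg, sum_neg_distrib]
    rw [neg_eq_zero, ← sum_range_inv_sq_eq_zero p hp3 (r : ZMod p) m hm]
    exact sum_erase _ (by rw [h0]; simp)
  obtain ⟨k, rfl⟩ := (ZMod.intCast_zmod_eq_zero_iff_dvd _ _).1 hσ
  exact ⟨t * k + q, by rw [h1]; ring⟩

open Finset in
theorem prod_erase_add_sq_mul_ne_zero (hm : (m : ZMod p) ≠ 0) (hi : i₀ < p)
    (h0 : (r + i₀ * m : ZMod p) = 0) (t : ℤ) :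
    ((∏ j ∈ (range p).erase i₀,
      ((r + j * m) * (p * m - r - j * m) + p ^ 2 * t) : ℤ) : ZMod p) ≠ 0 := by
  push_cast
  refine prod_ne_zero_iff.2 fun j hj => ?_
  have := add_mul_ne_zero_of_mem_erase hm hi h0 hj
  rw [ZMod.natCast_self]
  convert neg_ne_zero.2 (pow_ne_zero 2 this) using 1
  ring

end Block

theorem ascPochhammer_eval_eq_prod_range {R : Type*} [CommSemiring R] (n : ℕ) (x : R) :
    (ascPochhammer R n).eval x = ∏ j ∈ Finset.range n, (x + j) := by
  induction n with
  | zero => simp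
  | succ n ih => rw [ascPochhammer_succ_eval, ih, Finset.prod_range_succ]

open Finset in
theorem ascPochhammer_block_mul_reflect {K : Type*} [Field K] (p b : ℕ) (x : K) :
    (ascPochhammer K (b * p + p)).eval x * (ascPochhammer K (b * p + p)).eval (1 - x) =
      (ascPochhammer K (b * p)).eval x * (ascPochhammer K (b * p)).eval (1 - x) *
        ∏ j ∈ range p, ((x + j) * (p - x - j) + p ^ 2 * (b * (b + 1))) := by
  simp only [ascPochhammer_eval_eq_prod_range, prod_range_add]
  rw [← prod_range_reflect (M := K) (fun j => 1 - x + ((b * p + j : ℕ) : K)) p, mul_mul_mul_comm]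
  congr 1
  rw [← prod_mul_distrib]
  refine prod_congr rfl fun j hj => ?_
  have hj' : j + 1 ≤ p := by simpa using hj
  have : ((p - 1 - j : ℕ) : K) = p - 1 - j := by
    rw [Nat.sub_sub, add_comm 1 j, Nat.cast_sub hj']
    push_cast
    ring
  push_cast
  rw [this]
  ring

open Finset in
theorem ascPochhammer_block_one_sq {K : Type*} [Field K] (q b : ℕ) :
    ((ascPochhammer K (b * (q + 1) + (q + 1))).eval 1) ^ 2 =
      ((ascPochhammer K (b * (q + 1))).eval 1) ^ 2 * (((q + 1 : ℕ) : K) * (b + 1)) ^ 2 *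
        ∏ j ∈ range q, ((1 + j : K) * (q - j) + ((q + 1 : ℕ) : K) ^ 2 * (b * (b + 1))) := by
  have h : ∏ j ∈ range q, ((1 + j : K) * (q - j) + ((q + 1 : ℕ) : K) ^ 2 * (b * (b + 1))) =
      (∏ j ∈ range q, (1 + ((b * (q + 1) + j : ℕ) : K))) ^ 2 := by
    rw [sq (∏ j ∈ range q, _)]
    nth_rewrite 2 [← prod_range_reflect (M := K)]
    rw [← prod_mul_distrib]
    refine prod_congr rfl fun j hj => ?_
    have hj' : j + 1 ≤ q := by simpa using hj
    have : ((q - 1 - j : ℕ) : K) = q - 1 - j := by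
      rw [Nat.sub_sub, add_comm 1 j, Nat.cast_sub hj']
      push_cast
      ring
    push_cast
    rw [this]
    ring
  simp only [ascPochhammer_eval_eq_prod_range, prod_range_add _ (b * (q + 1))]
  rw [prod_range_succ _ q, h]
  push_cast
  ring

theorem padic_norm_ascPochhammer_div_factorial_le_one (p : ℕ) [Fact p.Prime] (n : ℕ) (x : ℚ)
    (hx : ‖(x : ℚ_[p])‖ ≤ 1) :
    ‖(((ascPochhammer ℚ n).eval x / (ascPochhammer ℚ n).eval 1 : ℚ) : ℚ_[p])‖ ≤ 1 := by
  obtain ⟨y, hy⟩ : ∃ y : ℤ_[p], (y : ℚ_[p]) = x := ⟨⟨x, hx⟩, rfl⟩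
  have h := PadicInt.norm_ascPochhammer_le n y
  have hcast : (((ascPochhammer ℤ_[p] n).eval y : ℤ_[p]) : ℚ_[p]) =
      (((ascPochhammer ℚ n).eval x : ℚ) : ℚ_[p]) := by
    simp only [ascPochhammer_eval_eq_prod_range]
    rw [Rat.cast_prod]
    refine (map_prod (PadicInt.Coe.ringHom (p := p)) _ _).trans ?_
    refine Finset.prod_congr rfl fun j _ => ?_
    rw [map_add, map_natCast, Rat.cast_add, Rat.cast_natCast, ← hy]
    rfl
  rw [PadicInt.norm_def, PadicInt.norm_def, hcast, PadicInt.coe_natCast] at h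
  rw [ascPochhammer_eval_one, Rat.cast_div, Rat.cast_natCast, norm_div]
  exact div_le_one_of_le₀ h (norm_nonneg _)

/-- With `u ≡ r / p` and `v ≡ -r / p` modulo `m`, the multiple of `p` in the first `p` terms of
`r, r + m, r + 2 * m, …` is `p * u`. -/
theorem exists_add_mul_eq_mul_residue {p r m u v : ℕ} (hr : 0 < r) (hrm : r < m)
    (hm : Nat.Coprime m p) (hu : u < m) (hv : v < m)
    (hures : ((p : ℤ) * u) ≡ (r : ℤ) [ZMOD (m : ℤ)])
    (hvres : ((p : ℤ) * v) ≡ -(r : ℤ) [ZMOD (m : ℤ)]) :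
    0 < u ∧ 0 < v ∧ u + v = m ∧ ∃ i < p, r + i * m = p * u := by
  obtain ⟨k, hk⟩ := hures.symm.dvd
  have hm0 : (0 : ℤ) < m := by omega
  have hk0 : 0 ≤ k := by
    by_contra! h
    have : (m : ℤ) * k ≤ m * (-1) := mul_le_mul_of_nonneg_left (by omega) hm0.le
    have : (0 : ℤ) ≤ p * u := by positivity
    omega
  have hu0 : 0 < u := by
    rcases Nat.eq_zero_or_pos u with rfl | h
    · have : (0 : ℤ) ≤ m * k := by positivity
      simp at hk
      omega
    · exact h
  have hsum : (m : ℤ) ∣ p * (u + v : ℕ) := by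
    have := (hures.add hvres).symm.dvd
    push_cast
    convert this using 1
    ring
  have hdvd : m ∣ u + v := hm.dvd_of_dvd_mul_left (by exact_mod_cast hsum)
  have huv : u + v = m := by
    obtain ⟨c, hc⟩ := hdvd
    have h1 : c < 2 := by
      by_contra! h
      have := Nat.mul_le_mul_left m h
      omega
    interval_cases c <;> omega
  refine ⟨hu0, by omega, huv, k.toNat, ?_, ?_⟩
  · have h1 : (m : ℤ) * k < m * p := by
      have : (p : ℤ) * u ≤ p * m := by gcongr
      have : (m : ℤ) * p = p * m := mul_comm _ _
      omega
    have := lt_of_mul_lt_mul_left h1 hm0.le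
    omega
  · zify
    rw [Int.toNat_of_nonneg hk0]
    linear_combination -hk

theorem stmt_11 (p : ℕ) (hp : p.Prime) (hp3 : 3 < p) (r m : ℕ)
    (hr : 0 < r) (hrm : r < m) (hm : Nat.Coprime m p) (a : ℕ) (ha : 1 ≤ a)
    (u v : ℕ) (hu : u < m) (hv : v < m)
    (hures : ((p : ℤ) * u) ≡ (r : ℤ) [ZMOD (m : ℤ)])
    (hvres : ((p : ℤ) * v) ≡ -(r : ℤ) [ZMOD (m : ℤ)]) :
    pcong p 3
      ((ascPochhammer ℚ (a * p)).eval ((r : ℚ) / m) *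
          (ascPochhammer ℚ (a * p)).eval (1 - (r : ℚ) / m) /
        ((ascPochhammer ℚ (a * p)).eval 1) ^ 2)
      ((ascPochhammer ℚ ((a - 1) * p)).eval ((r : ℚ) / m) *
          (ascPochhammer ℚ ((a - 1) * p)).eval (1 - (r : ℚ) / m) /
          ((ascPochhammer ℚ ((a - 1) * p)).eval 1) ^ 2 *
        ((ascPochhammer ℚ p).eval ((r : ℚ) / m) *
            (ascPochhammer ℚ p).eval (1 - (r : ℚ) / m) /
          ((ascPochhammer ℚ p).eval 1) ^ 2) *
        (1 / (a : ℚ) ^ 2) *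
        (1 + (a : ℚ) * ((a : ℚ) - 1) * (m : ℚ) ^ 2 / ((u : ℚ) * v))) := by
  have : Fact p.Prime := ⟨hp⟩
  obtain ⟨hu0, hv0, huv, i₀, hi₀, hiu⟩ :=
    exists_add_mul_eq_mul_residue hr hrm hm hu hv hures hvres
  obtain ⟨b, rfl⟩ : ∃ b, a = b + 1 := ⟨a - 1, by omega⟩
  obtain ⟨q, hq⟩ : ∃ q, p = q + 1 := ⟨p - 1, by omega⟩
  have hm0 : (m : ℚ) ≠ 0 := by
    have : m ≠ 0 := by omega
    exact_mod_cast this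
  have hp0 : (p : ℚ) ≠ 0 := by exact_mod_cast hp.ne_zero
  have hmp : ((m : ℤ) : ZMod p) ≠ 0 := by
    rw [Int.cast_natCast, Ne, ZMod.natCast_eq_zero_iff]
    exact (Nat.Prime.coprime_iff_not_dvd hp).1 hm.symm
  have hiu0 : (((r : ℤ) : ZMod p) + i₀ * ((m : ℤ) : ZMod p)) = 0 := by
    have := congrArg (Nat.cast : ℕ → ZMod p) hiu
    push_cast at this ⊢
    rw [this, ZMod.natCast_self, zero_mul]
  have hq0 : (((1 : ℤ) : ZMod p) + q * ((1 : ℤ) : ZMod p)) = 0 := by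
    have := congrArg (Nat.cast : ℕ → ZMod p) hq
    rw [ZMod.natCast_self] at this
    push_cast at this ⊢
    linear_combination -this
  have h11 : ((1 : ℤ) : ZMod p) ≠ 0 := by simp
  let N : ℤ → ℤ := fun t => ∏ j ∈ (Finset.range p).erase i₀,
    (((r : ℤ) + j * m) * (p * m - r - j * m) + p ^ 2 * t)
  let D : ℤ → ℤ := fun t => ∏ j ∈ (Finset.range p).erase q,
    (((1 : ℤ) + j * 1) * (p * 1 - 1 - j * 1) + p ^ 2 * t)
  have hN (t : ℤ) : (p : ℤ) ^ 3 ∣ N t - N 0 := by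
    simpa [N] using pow_three_dvd_prod_erase_sub hp3 hmp hi₀ hiu0 t
  have hD (t : ℤ) : (p : ℤ) ^ 3 ∣ D t - D 0 := by
    simpa [D] using pow_three_dvd_prod_erase_sub hp3 h11 (by omega) hq0 t
  have hN0 (t : ℤ) : ((N t : ℤ) : ZMod p) ≠ 0 := prod_erase_add_sq_mul_ne_zero hmp hi₀ hiu0 t
  have hD0 (t : ℤ) : ((D t : ℤ) : ZMod p) ≠ 0 :=
    prod_erase_add_sq_mul_ne_zero h11 (by omega) hq0 t
  have hNQ (t : ℤ) : (N t : ℚ) ≠ 0 := fun h => hN0 t (by rw [Int.cast_eq_zero.1 h, Int.cast_zero])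
  have hDQ (t : ℤ) : (D t : ℚ) ≠ 0 := fun h => hD0 t (by rw [Int.cast_eq_zero.1 h, Int.cast_zero])
  have hiuQ : (r : ℚ) + i₀ * m = p * u := by exact_mod_cast hiu
  have huvQ : (u : ℚ) + v = m := by exact_mod_cast huv
  have hx (b : ℕ) : (ascPochhammer ℚ (b * p + p)).eval ((r : ℚ) / m) *
      (ascPochhammer ℚ (b * p + p)).eval (1 - (r : ℚ) / m) =
      (ascPochhammer ℚ (b * p)).eval ((r : ℚ) / m) *
      (ascPochhammer ℚ (b * p)).eval (1 - (r : ℚ) / m) *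
      (p ^ 2 * (u * v + m ^ 2 * (b * (b + 1))) * N (m ^ 2 * (b * (b + 1))) / (m ^ 2) ^ p) := by
    rw [ascPochhammer_block_mul_reflect]
    congr 1
    have hterm : ∀ j ∈ Finset.range p, (((r : ℚ) / m + j) * (p - r / m - j) +
        p ^ 2 * (b * (b + 1))) = ((((r : ℤ) + j * m) * (p * m - r - j * m) +
        p ^ 2 * (m ^ 2 * (b * (b + 1))) : ℤ) : ℚ) / m ^ 2 := by
      intro j _
      push_cast
      field_simp
    rw [Finset.prod_congr rfl hterm, Finset.prod_div_distrib, Finset.prod_const,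
      Finset.card_range, ← Finset.mul_prod_erase _ _ (Finset.mem_range.2 hi₀)]
    simp only [N]
    push_cast
    congr 2
    rw [hiuQ, sub_sub, hiuQ, ← huvQ]
    ring
  have h1 (b : ℕ) : ((ascPochhammer ℚ (b * p + p)).eval 1) ^ 2 =
      ((ascPochhammer ℚ (b * p)).eval 1) ^ 2 * (p * (b + 1)) ^ 2 * D (b * (b + 1)) := by
    have herase : (Finset.range p).erase q = Finset.range q := by
      rw [hq, Finset.range_add_one, Finset.erase_insert (by simp)]
    have hqQ : (p : ℚ) = q + 1 := by exact_mod_cast hq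
    have := ascPochhammer_block_one_sq (K := ℚ) q b
    rw [← hq] at this
    rw [this]
    simp only [D, herase]
    congr 1
    push_cast
    refine Finset.prod_congr rfl fun j _ => ?_
    rw [hqQ]
    ring
  have hx0 := hx 0
  have h10 := h1 0
  simp only [zero_mul, zero_add, Nat.cast_zero, mul_zero, add_zero, ascPochhammer_zero,
    Polynomial.eval_one, one_mul, one_pow, mul_one] at hx0 h10
  have hnorm (k : ℤ) (hk : (k : ZMod p) ≠ 0) : ‖(k : ℚ_[p])‖ = 1 := by
    rw [Padic.norm_intCast_eq_one_iff, isCoprime_comm,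
      Prime.coprime_iff_not_dvd (Nat.prime_iff_prime_int.1 hp)]
    exact fun h => hk ((ZMod.intCast_zmod_eq_zero_iff_dvd _ _).2 h)
  have hxnorm : ‖(((r : ℚ) / m : ℚ) : ℚ_[p])‖ ≤ 1 := by
    have h2 := hnorm m hmp
    rw [Int.cast_natCast] at h2
    push_cast
    rw [norm_div, h2, div_one]
    exact_mod_cast Padic.norm_int_le_one (p := p) r
  have hxnorm' : ‖((1 - (r : ℚ) / m : ℚ) : ℚ_[p])‖ ≤ 1 := by
    rw [Rat.cast_sub, Rat.cast_one]
    rw [sub_eq_add_neg]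
    exact (Padic.nonarchimedean _ _).trans (max_le (by simp) (by rwa [norm_neg]))
  have hL := mul_le_one₀
    (padic_norm_ascPochhammer_div_factorial_le_one p (b * p + p) _ hxnorm) (norm_nonneg _)
    (padic_norm_ascPochhammer_div_factorial_le_one p (b * p + p) _ hxnorm')
  rw [← norm_mul, ← Rat.cast_mul, div_mul_div_comm, ← sq] at hL
  rw [Nat.add_sub_cancel, Nat.succ_mul]
  have hxb := hx b
  have h1b := h1 b
  obtain ⟨e₁, he₁⟩ := hN (m ^ 2 * (b * (b + 1)))
  obtain ⟨e₂, he₂⟩ := hD (b * (b + 1))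
  set N' := N (m ^ 2 * (b * (b + 1)))
  set D' := D (b * (b + 1))
  have hN' : (N' : ℚ) ≠ 0 := hNQ _
  have hD' : (D' : ℚ) ≠ 0 := hDQ _
  have hND : ((N' * D 0 : ℤ) : ZMod p) ≠ 0 := by
    rw [Int.cast_mul]
    exact mul_ne_zero (hN0 _) (hD0 _)
  generalize hLdef : (ascPochhammer ℚ (b * p + p)).eval ((r : ℚ) / m) *
    (ascPochhammer ℚ (b * p + p)).eval (1 - (r : ℚ) / m) /
    ((ascPochhammer ℚ (b * p + p)).eval 1) ^ 2 = L at hL ⊢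
  refine ⟨L * ((e₁ * D 0 - N 0 * e₂ : ℤ) / (N' * D 0 : ℤ)), ?_, ?_⟩
  · have : ‖((L * ((e₁ * D 0 - N 0 * e₂ : ℤ) / (N' * D 0 : ℤ)) : ℚ) : ℚ_[p])‖ ≤ 1 := by
      rw [Rat.cast_mul, Rat.cast_div, Rat.cast_intCast, Rat.cast_intCast, norm_mul, norm_div,
        hnorm _ hND, div_one]
      exact mul_le_one₀ hL (norm_nonneg _) (Padic.norm_int_le_one _)
    rwa [Padic.norm_rat_le_one_iff_padicValuation_le_one, Rat.padicValuation_le_one_iff] at this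
  · have he₁Q : (N' : ℚ) - N 0 = p ^ 3 * e₁ := by exact_mod_cast he₁
    have he₂Q : (D' : ℚ) - D 0 = p ^ 3 * e₂ := by exact_mod_cast he₂
    have hkey : (p : ℚ) ^ 3 * (L * ((e₁ * D 0 - N 0 * e₂ : ℤ) / (N' * D 0 : ℤ))) =
        L * (1 - N 0 * D' / (N' * D 0)) := by
      have hD00 := hDQ 0
      push_cast
      field_simp
      linear_combination L * N 0 * he₂Q - L * D 0 * he₁Q
    rw [hkey, ← hLdef, hxb, hx0, h1b, h10]
    have hD00 := hDQ 0
    have hE : (ascPochhammer ℚ (b * p)).eval 1 ≠ 0 := by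
      rw [ascPochhammer_eval_one]
      exact_mod_cast (b * p).factorial_ne_zero
    have hb : (b : ℚ) + 1 ≠ 0 := by positivity
    have hu' : (u : ℚ) ≠ 0 := by positivity
    have hv' : (v : ℚ) ≠ 0 := by positivity
    generalize (ascPochhammer ℚ (b * p)).eval 1 = E at hE ⊢
    generalize (ascPochhammer ℚ (b * p)).eval ((r : ℚ) / m) = A
    generalize (ascPochhammer ℚ (b * p)).eval (1 - (r : ℚ) / m) = B
    push_cast
    field_simp
    ring
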